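/- Let (X,‖·‖) be a Banach space and J ⊂ ℝ₊ an interval. Consider the family of C¹ functionals I_λ(u) = A(u) − λB(u) on X for λ ∈ J, where B is nonnegative, either A(u) → +∞ or B(u) → +∞ as ‖u‖ → ∞, and I_λ(0) = 0 for all λ. For λ ∈ J set Γ_λ = {γ ∈ C([0,1],X) : γ(0) = 0, I_λ(γ(1)) < 0} and c_λ = inf_{γ∈Γ_λ} max_{t∈[0,1]} I_λ(γ(t)). If for every λ ∈ J the set Γ_λ is nonempty and c_λ > 0, then for almost every λ ∈ J there is a sequence (v_n) in X such that (i) (v_n) is bounded, (ii) I_λ(v_n) → c_λ, and (iii) I_λ'(v_n) → 0 in the dual space X*. -/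

import Mathlib

open MeasureTheory Filter Topology

noncomputable section

/-- Ekeland's variational principle, in its weak form. -/
theorem exists_ekeland_point {Y : Type*} [PseudoMetricSpace Y] [CompleteSpace Y]
    {f : Y → ℝ} (hf : LowerSemicontinuous f) {m : ℝ} (hm : ∀ y, m ≤ f y)
    {k : ℝ} (hk : 0 < k) (x₀ : Y) :
    ∃ x, f x + k * dist x₀ x ≤ f x₀ ∧ ∀ y, f x ≤ f y + k * dist x y := by
  let S : Y → Set Y := fun x => {y | f y + k * dist x y ≤ f x}
  have self_mem : ∀ x, x ∈ S x := fun x => by simp [S]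
  have S_trans : ∀ {x y z}, y ∈ S x → z ∈ S y → z ∈ S x := by
    intro x y z hy hz
    have := mul_le_mul_of_nonneg_left (dist_triangle x y z) hk.le
    simp only [S, Set.mem_ofPred_eq] at *
    linarith
  have S_closed : ∀ x, IsClosed (S x) := by
    intro x
    have hcont : Continuous fun y => k * dist x y := by fun_prop
    exact (hf.add hcont.lowerSemicontinuous).isClosed_preimage (f x)
  have step : ∀ (n : ℕ) (x : Y), ∃ y ∈ S x, ∀ z ∈ S x, f y ≤ f z + (1 / 2 : ℝ) ^ n := by
    intro n x
    have hne : (f '' S x).Nonempty := ⟨_, x, self_mem x, rfl⟩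
    have hbdd : BddBelow (f '' S x) := ⟨m, by rintro _ ⟨y, -, rfl⟩; exact hm y⟩
    have hpow : (0 : ℝ) < (1 / 2) ^ n := by positivity
    obtain ⟨_, ⟨y, hy, rfl⟩, hlt⟩ := exists_lt_of_csInf_lt hne (lt_add_of_pos_right _ hpow)
    refine ⟨y, hy, fun z hz => ?_⟩
    have := csInf_le hbdd ⟨z, hz, rfl⟩
    linarith
  choose next next_mem next_le using step
  let u : ℕ → Y := fun n => Nat.rec x₀ (fun n x => next n x) n
  have u_succ : ∀ n, u (n + 1) = next n (u n) := fun n => rfl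
  have u_mem : ∀ n p, n ≤ p → u p ∈ S (u n) := by
    intro n p hnp
    induction p, hnp using Nat.le_induction with
    | base => exact self_mem _
    | succ p _ ih => exact S_trans ih (by rw [u_succ]; exact next_mem p (u p))
  have u_near : ∀ n, ∀ z ∈ S (u n), f (u (n + 1)) ≤ f z + (1 / 2 : ℝ) ^ n := by
    intro n z hz
    rw [u_succ]
    exact next_le n (u n) z hz
  have pow_lim : Tendsto (fun n : ℕ => (1 / 2 : ℝ) ^ n) atTop (𝓝 0) :=
    tendsto_pow_atTop_nhds_zero_of_lt_one (by norm_num) (by norm_num)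
  have u_cauchy : CauchySeq fun n => u (n + 1) := by
    refine cauchySeq_of_le_tendsto_0' (fun n : ℕ => (1 / 2 : ℝ) ^ n / k) (fun n p hnp => ?_)
      (by simpa using pow_lim.div_const k)
    have h₁ := u_mem (n + 1) (p + 1) (by omega)
    have h₂ := u_near n _ (u_mem n (p + 1) (by omega))
    simp only [S, Set.mem_ofPred_eq] at h₁
    rw [le_div_iff₀ hk]
    linarith
  obtain ⟨x, hx⟩ := cauchySeq_tendsto_of_complete u_cauchy
  have x_mem : ∀ n, x ∈ S (u n) := fun n =>
    (S_closed (u n)).mem_of_tendsto hx <|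
      (eventually_ge_atTop n).mono fun p hp => u_mem n (p + 1) (by omega)
  refine ⟨x, x_mem 0, fun y => ?_⟩
  by_contra! hy
  have hxy : f x ≤ f y := by
    refine ge_of_tendsto' (add_zero (f y) ▸ pow_lim.const_add (f y)) fun n : ℕ => ?_
    have h₁ := u_near n y (S_trans (x_mem n) hy.le)
    have h₂ := x_mem (n + 1)
    simp only [S, Set.mem_ofPred_eq] at h₂
    have : 0 ≤ k * dist (u (n + 1)) x := by positivity
    linarith
  have : 0 ≤ k * dist x y := by positivity
  linarith

section PathSup

variable {X : Type*} [TopologicalSpace X] {T : Type*} [TopologicalSpace T] [CompactSpace T]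

theorem exists_eq_iSup_comp [Nonempty T] {I : X → ℝ} (hI : Continuous I) (γ : C(T, X)) :
    ∃ t, I (γ t) = ⨆ s, I (γ s) :=
  (isCompact_range (hI.comp γ.continuous)).sSup_mem (Set.range_nonempty _)

theorem le_iSup_comp {I : X → ℝ} (hI : Continuous I) (γ : C(T, X)) (t : T) :
    I (γ t) ≤ ⨆ s, I (γ s) :=
  le_ciSup (isCompact_range (hI.comp γ.continuous)).bddAbove t

theorem lowerSemicontinuous_iSup_comp [Nonempty T] {I : X → ℝ} (hI : Continuous I) :
    LowerSemicontinuous fun γ : C(T, X) => ⨆ t, I (γ t) := by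
  intro γ y hy
  obtain ⟨t, ht⟩ := exists_eq_iSup_comp hI γ
  have hcont : Continuous fun σ : C(T, X) => I (σ t) := hI.comp (by fun_prop)
  filter_upwards [hcont.continuousAt.eventually (lt_mem_nhds (ht ▸ hy : y < I (γ t)))] with σ hσ
  exact hσ.trans_le (le_iSup_comp hI σ t)

end PathSup

section Minimax

variable {X : Type*} [NormedAddCommGroup X] [NormedSpace ℝ X]
  {T : Type*} [TopologicalSpace T] [CompactSpace T]

/-- A continuous field of descent directions along `η`, vanishing off the open set `U`. -/
theorem exists_descent_field [T2Space T] {I : X → ℝ} (hI : ContDiff ℝ 1 I) (η : C(T, X))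
    {K U : Set T} (hK : IsClosed K) (hU : IsOpen U) (hKU : K ⊆ U) {r : ℝ}
    (hr : ∀ t ∈ K, r < ‖fderiv ℝ I (η t)‖) :
    ∃ w : C(T, X), ∀ t, ‖w t‖ ≤ 1 ∧ (t ∈ K → fderiv ℝ I (η t) (w t) < -r) ∧
      (t ∉ U → w t = 0) := by
  have hfd : Continuous (fderiv ℝ I) := hI.continuous_fderiv one_ne_zero
  let C : T → Set X := fun t =>
    {v | ‖v‖ ≤ 1 ∧ (t ∈ K → fderiv ℝ I (η t) v < -r) ∧ (t ∉ U → v = 0)}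
  refine exists_continuous_forall_mem_convex_of_local_const (t := C) (fun t => ?_) fun t => ?_
  · rintro v ⟨hv₁, hv₂, hv₃⟩ v' ⟨hv'₁, hv'₂, hv'₃⟩ a b ha hb hab
    refine ⟨?_, fun ht => ?_, fun ht => by simp [hv₃ ht, hv'₃ ht]⟩
    · have := convex_closedBall (0 : X) 1 (by simpa using hv₁) (by simpa using hv'₁) ha hb hab
      simpa using this
    · exact (convex_halfSpace_lt (fderiv ℝ I (η t)).isLinear (-r)) (hv₂ ht) (hv'₂ ht)
        ha hb hab
  · by_cases ht : t ∈ K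
    · obtain ⟨v, hv₁, hv⟩ : ∃ v, ‖v‖ < 1 ∧ fderiv ℝ I (η t) v < -r := by
        obtain ⟨v, hv₁, hv⟩ := (fderiv ℝ I (η t)).exists_lt_apply_of_lt_opNorm (hr t ht)
        rcases lt_abs.1 (Real.norm_eq_abs _ ▸ hv) with h | h
        · exact ⟨-v, by simpa using hv₁, by simpa using h⟩
        · exact ⟨v, hv₁, by linarith⟩
      have hcont : Continuous fun s => fderiv ℝ I (η s) v := by fun_prop
      refine ⟨v, ?_⟩
      filter_upwards [hcont.continuousAt.eventually (gt_mem_nhds hv),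
        hU.mem_nhds (hKU ht)] with s hs hsU
      exact ⟨hv₁.le, fun _ => hs, fun h => (h hsU).elim⟩
    · refine ⟨0, ?_⟩
      filter_upwards [hK.isOpen_compl.mem_nhds ht] with s hs
      exact ⟨by simp, fun h => (hs h).elim, fun _ => rfl⟩

/-- Moving `η` along a field of descent directions at its maximum points lowers the maximum
at a linear rate. -/
theorem exists_forall_add_smul_lt {I : X → ℝ} (hI : ContDiff ℝ 1 I) (η w : C(T, X)) {m δ : ℝ}
    (hδ : 0 < δ) (hm : ∀ t, I (η t) ≤ m) (hw : ∀ t, ‖w t‖ ≤ 1)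
    (hdesc : ∀ t, I (η t) = m → fderiv ℝ I (η t) (w t) < -(2 * δ)) :
    ∃ s : ℝ, 0 < s ∧ ∀ t, I (η t + s • w t) < m - δ * s := by
  have key : ∀ᶠ s : ℝ in 𝓝 0, ∀ t ∈ (Set.univ : Set T),
      0 < s → I (η t + s • w t) < m - δ * s := by
    refine isCompact_univ.eventually_forall_of_forall_eventually fun t _ => ?_
    rcases (hm t).lt_or_eq with ht | ht
    · have hcont : Continuous fun z : ℝ × T => I (η z.2 + z.1 • w z.2) + δ * z.1 := by
        have := hI.continuous
        fun_prop
      filter_upwards [hcont.continuousAt.eventually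
        (gt_mem_nhds (by simpa using ht : _ < m))] with z hz _
      linarith
    · have hstrict := (hI.contDiffAt (x := η t)).hasStrictFDerivAt one_ne_zero
      have hpair : Tendsto (fun z : ℝ × T => (η z.2 + z.1 • w z.2, η z.2))
          (𝓝 ((0 : ℝ), t)) (𝓝 (η t, η t)) := by
        have hcont : Continuous fun z : ℝ × T => (η z.2 + z.1 • w z.2, η z.2) := by fun_prop
        simpa using hcont.tendsto ((0 : ℝ), t)
      have hlin : Continuous fun z : ℝ × T => fderiv ℝ I (η t) (w z.2) := by fun_prop
      filter_upwards [hpair.eventually (hstrict.isLittleO.bound hδ),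
        hlin.continuousAt.eventually (gt_mem_nhds (hdesc t ht))] with z hz hz' hs
      have h₁ := (le_abs_self _).trans hz
      simp only [add_sub_cancel_left, map_smul, smul_eq_mul, norm_smul, Real.norm_eq_abs,
        abs_of_pos hs] at h₁
      have h₂ : δ * (z.1 * ‖w z.2‖) ≤ δ * z.1 := by
        have := mul_le_mul_of_nonneg_left (hw z.2) hs.le
        nlinarith
      have h₃ := mul_lt_mul_of_pos_left hz' hs
      have h₄ := hm z.2
      nlinarith
  obtain ⟨s, hs, hs₀⟩ :=
    ((key.filter_mono nhdsWithin_le_nhds).and (self_mem_nhdsWithin (s := Set.Ioi (0 : ℝ)))).exists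
  exact ⟨s, hs₀, fun t => hs t trivial hs₀⟩

/-- Localized minimax principle: if the level `c` cannot be avoided by deforming `γ` above the
level `c - ε`, and `γ` stays below `c + δ ^ 2`, then there is an almost critical point near the
part of `γ` lying above `c - ε`. -/
theorem exists_almost_critical_of_minimax [CompleteSpace X] [T2Space T] {I : X → ℝ}
    (hI : ContDiff ℝ 1 I) (γ : C(T, X)) {c ε δ R : ℝ} (hε : 0 < ε) (hδ : 0 < δ)
    (hup : ∀ t, I (γ t) ≤ c + δ ^ 2) (hloc : ∀ t, c - ε < I (γ t) → ‖γ t‖ ≤ R)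
    (hlink : ∀ σ : C(T, X), (∀ t, I (γ t) ≤ c - ε → σ t = γ t) → ∃ t, c ≤ I (σ t)) :
    ∃ u, ‖u‖ ≤ R + δ ∧ c ≤ I u ∧ I u ≤ c + δ ^ 2 ∧ ‖fderiv ℝ I u‖ ≤ 2 * δ := by
  have hIc := hI.continuous
  have : Nonempty T := ⟨(hlink γ fun _ _ => rfl).choose⟩
  let S : Set C(T, X) := {σ | ∀ t, I (γ t) ≤ c - ε → σ t = γ t}
  have hS : IsClosed S := by
    simp only [S, Set.ofPred_forall]
    exact isClosed_iInter fun t => isClosed_iInter fun _ =>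
      isClosed_eq (by fun_prop) continuous_const
  have : CompleteSpace S := hS.completeSpace_coe
  have hlow : ∀ σ : S, c ≤ ⨆ t, I (σ.1 t) := fun σ =>
    let ⟨t, ht⟩ := hlink σ σ.2
    ht.trans (le_iSup_comp hIc σ.1 t)
  obtain ⟨⟨η, hηS⟩, hηγ, hη⟩ := exists_ekeland_point
    ((lowerSemicontinuous_iSup_comp (T := T) hIc).comp continuous_subtype_val) hlow hδ
    (⟨γ, fun _ _ => rfl⟩ : S)
  simp only [Function.comp_apply, Subtype.dist_eq] at hηγ hη
  have hηlow := hlow ⟨η, hηS⟩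
  have hγup : ⨆ t, I (γ t) ≤ c + δ ^ 2 := ciSup_le hup
  have hdist : dist γ η ≤ δ := by
    refine le_of_mul_le_mul_left ?_ hδ
    simp only at hηlow
    nlinarith
  by_contra! hcon
  have hIη : Continuous fun t => I (η t) := by fun_prop
  have hIγ : Continuous fun t => I (γ t) := by fun_prop
  have hKU : {t | I (η t) = ⨆ s, I (η s)} ⊆ {t | c - ε < I (γ t)} := by
    intro t ht
    by_contra h
    have h' : I (γ t) ≤ c - ε := not_lt.1 h
    have heq : I (η t) = ⨆ s, I (η s) := ht
    rw [hηS t h'] at heq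
    simp only at hηlow
    linarith
  obtain ⟨w, hw⟩ := exists_descent_field hI η (isClosed_eq hIη continuous_const)
    (isOpen_lt continuous_const hIγ) hKU (r := 2 * δ) fun t ht => by
      have heq : I (η t) = ⨆ s, I (η s) := ht
      refine hcon (η t) ?_ (heq ▸ hηlow) ?_
      · have h₁ := (ContinuousMap.dist_apply_le_dist t).trans hdist
        rw [dist_comm, dist_eq_norm] at h₁
        have h₂ := norm_le_norm_add_norm_sub' (η t) (γ t)
        linarith [hloc t (hKU ht)]
      · have : 0 ≤ δ * dist γ η := by positivity
        linarith
  obtain ⟨s, hs, hlt⟩ := exists_forall_add_smul_lt hI η w hδ (le_iSup_comp hIc η)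
    (fun t => (hw t).1) (fun t ht => (hw t).2.1 ht)
  have hσS : η + s • w ∈ S := fun t ht => by
    simp [(hw t).2.2 (not_lt.2 ht), hηS t ht]
  obtain ⟨t, ht⟩ := exists_eq_iSup_comp hIc (η + s • w)
  have hle := hη ⟨η + s • w, hσS⟩
  have hmove : dist η (η + s • w) ≤ s := by
    refine (ContinuousMap.dist_le hs.le).2 fun t => ?_
    have := mul_le_mul_of_nonneg_left (hw t).1 hs.le
    simpa [norm_smul, abs_of_pos hs] using this
  have hlt' := hlt t
  simp only [ContinuousMap.add_apply, ContinuousMap.smul_apply] at ht hle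
  have := mul_le_mul_of_nonneg_left hmove hδ.le
  linarith

end Minimax

/-- A variant of Jeanjean's monotonicity trick (Theorem 2.1): for a family
`I_λ = A − λB` of `C¹` functionals on a Banach space `X`, with `B ≥ 0`, `A` or `B` coercive,
`I_λ(0) = 0`, nonempty sets of mountain-pass paths and positive mountain-pass levels `c_λ`,
for almost every `λ ∈ J` there is a bounded Palais–Smale sequence for `I_λ` at level `c_λ`. -/
theorem jeanjean_monotonicity_trick
    {X : Type*} [NormedAddCommGroup X] [NormedSpace ℝ X] [CompleteSpace X]
    (A B : X → ℝ) (J : Set ℝ)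
    (hJpos : J ⊆ Set.Ioi (0 : ℝ)) (hJint : J.OrdConnected)
    (hC1 : ∀ lam ∈ J, ContDiff ℝ 1 (fun u => A u - lam * B u))
    (hBnonneg : ∀ u, 0 ≤ B u)
    (hcoercive : Tendsto A (Bornology.cobounded X) atTop ∨
      Tendsto B (Bornology.cobounded X) atTop)
    (hzero : ∀ lam ∈ J, A 0 - lam * B 0 = 0)
    (Γ : ℝ → Set (C(Set.Icc (0:ℝ) 1, X)))
    (hΓ : ∀ lam, Γ lam = {γ | γ ⟨0, by norm_num⟩ = 0 ∧
      A (γ ⟨1, by norm_num⟩) - lam * B (γ ⟨1, by norm_num⟩) < 0})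
    (c : ℝ → ℝ)
    (hc : ∀ lam, c lam =
      sInf ((fun γ : C(Set.Icc (0:ℝ) 1, X) =>
        sSup ((fun t => A (γ t) - lam * B (γ t)) '' Set.univ)) '' Γ lam))
    (hΓne : ∀ lam ∈ J, (Γ lam).Nonempty)
    (hcpos : ∀ lam ∈ J, 0 < c lam) :
    ∀ᵐ lam ∂(volume.restrict J), lam ∈ J →
      ∃ v : ℕ → X,
        (∃ M : ℝ, ∀ n, ‖v n‖ ≤ M) ∧
        Tendsto (fun n => A (v n) - lam * B (v n)) atTop (𝓝 (c lam)) ∧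
        Tendsto (fun n => ‖fderiv ℝ (fun u => A u - lam * B u) (v n)‖) atTop (𝓝 0) := by
  have hcont : ∀ lam ∈ J, Continuous fun u => A u - lam * B u :=
    fun lam hlam => (hC1 lam hlam).continuous
  replace hc : ∀ lam, c lam = sInf ((fun γ : C(Set.Icc (0:ℝ) 1, X) =>
      ⨆ t, (A (γ t) - lam * B (γ t))) '' Γ lam) := fun lam => by
    simp only [hc lam, Set.image_univ, iSup]
  have c_le : ∀ lam ∈ J, ∀ γ ∈ Γ lam, c lam ≤ ⨆ t, (A (γ t) - lam * B (γ t)) := by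
    intro lam hlam γ hγ
    rw [hc]
    refine csInf_le ⟨0, ?_⟩ ⟨γ, hγ, rfl⟩
    rintro _ ⟨σ, hσ, rfl⟩
    rw [hΓ] at hσ
    refine le_of_eq_of_le ?_ (le_iSup_comp (hcont lam hlam) σ ⟨0, by norm_num⟩)
    rw [hσ.1, hzero lam hlam]
  have Γ_mono : ∀ mu lam, mu ≤ lam → Γ mu ⊆ Γ lam := by
    intro mu lam hle γ hγ
    rw [hΓ] at hγ ⊢
    refine ⟨hγ.1, lt_of_le_of_lt ?_ hγ.2⟩
    linarith [mul_le_mul_of_nonneg_right hle (hBnonneg (γ ⟨1, by norm_num⟩))]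
  have c_anti : AntitoneOn c J := by
    intro mu hmu lam hlam hle
    rw [hc mu]
    refine le_csInf ((hΓne mu hmu).image _) ?_
    rintro _ ⟨γ, hγ, rfl⟩
    refine (c_le lam hlam γ (Γ_mono mu lam hle hγ)).trans (ciSup_le fun t => ?_)
    refine le_trans ?_ (le_iSup_comp (hcont mu hmu) γ t)
    linarith [mul_le_mul_of_nonneg_right hle (hBnonneg (γ t))]
  have ae_not_least : ∀ᵐ lam ∂(volume.restrict J), ¬ IsLeast J lam := by
    refine ae_restrict_of_ae ((Set.Subsingleton.measure_zero ?_ volume :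
      volume {lam | IsLeast J lam} = 0) |> measure_eq_zero_iff_ae_notMem.1)
    exact fun a ha b hb => ha.unique hb
  filter_upwards [c_anti.neg.ae_differentiableWithinAt hJint.measurableSet, ae_not_least]
    with lam hdiff hleast hlam
  obtain ⟨mu₀, hmu₀, hmu₀lam⟩ : ∃ mu ∈ J, mu < lam := by
    by_contra! h
    exact hleast ⟨hlam, h⟩
  obtain ⟨K, hK, hbound⟩ := hdiff.hasFDerivWithinAt.isBigO_sub.exists_pos
  have hIoo : Set.Ioo mu₀ lam ⊆ J := fun x hx => hJint.out hmu₀ hlam ⟨hx.1.le, hx.2.le⟩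
  have hslope : ∀ᶠ mu in 𝓝[<] lam, c mu - c lam ≤ K * (lam - mu) := by
    have hle : 𝓝[<] lam ≤ 𝓝[J] lam :=
      nhdsWithin_le_of_mem (mem_of_superset (Ioo_mem_nhdsLT hmu₀lam) hIoo)
    filter_upwards [hle hbound.bound, self_mem_nhdsWithin] with mu hmu hlt
    have hlt' : mu < lam := hlt
    have h := (neg_abs_le _).trans' (neg_le_neg hmu)
    simp only [Real.norm_eq_abs, abs_of_neg (sub_neg.2 hlt')] at h
    linarith
  obtain ⟨R, hR⟩ : ∃ R, ∀ u, B u ≤ K + 2 → A u ≤ c lam + (K + 1) + lam * (K + 2) → ‖u‖ ≤ R := by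
    have hev : ∀ᶠ u in Bornology.cobounded X,
        ¬ (B u ≤ K + 2 ∧ A u ≤ c lam + (K + 1) + lam * (K + 2)) := by
      rcases hcoercive with h | h
      · exact (h.eventually_gt_atTop _).mono fun u hu h' => hu.not_ge h'.2
      · exact (h.eventually_gt_atTop _).mono fun u hu h' => hu.not_ge h'.1
    obtain ⟨R, -, hR⟩ := hasBasis_cobounded_norm.eventually_iff.1 hev
    refine ⟨R, fun u hB hA => ?_⟩
    by_contra! h
    exact hR h.le ⟨hB, hA⟩
  have almost_critical : ∀ δ : ℝ, 0 < δ → ∃ u, ‖u‖ ≤ R + δ ∧ c lam ≤ A u - lam * B u ∧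
      A u - lam * B u ≤ c lam + δ ^ 2 ∧ ‖fderiv ℝ (fun u => A u - lam * B u) u‖ ≤ 2 * δ := by
    intro δ hδ
    have hc0 := hcpos lam hlam
    have hpos : 0 < δ ^ 2 / (K + 1) := by positivity
    have hnear : ∀ r : ℝ, 0 < r → ∀ᶠ mu in 𝓝[<] lam, lam - mu < r := fun r hr => by
      filter_upwards [Ioo_mem_nhdsLT (sub_lt_self lam hr)] with mu hmu
      linarith [hmu.1]
    obtain ⟨mu, hmu_slope, hmu_mem, hmu_one, hmu_c, hmu_δ⟩ :=
      (hslope.and <| (Filter.Eventually.and (Ioo_mem_nhdsLT hmu₀lam)) <| (hnear 1 one_pos).and <|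
        (hnear _ hc0).and (hnear _ hpos)).exists
    rw [lt_div_iff₀ (by positivity)] at hmu_δ
    have hmu := hIoo hmu_mem
    have hlt : 0 < lam - mu := sub_pos.2 hmu_mem.2
    obtain ⟨_, ⟨γ, hγ, rfl⟩, hγlt⟩ := exists_lt_of_csInf_lt ((hΓne mu hmu).image _)
      (lt_add_of_pos_right _ hlt)
    rw [← hc mu] at hγlt
    have hγ_mu : ∀ t, A (γ t) - mu * B (γ t) < c mu + (lam - mu) := fun t =>
      (le_iSup_comp (hcont mu hmu) γ t).trans_lt hγlt
    have hγ_lam : ∀ t, A (γ t) - lam * B (γ t) ≤ c lam + (K + 1) * (lam - mu) := fun t => by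
      linarith [hγ_mu t, mul_nonneg hlt.le (hBnonneg (γ t))]
    refine exists_almost_critical_of_minimax (hC1 lam hlam) γ hlt hδ
      (fun t => by linarith [hγ_lam t]) (fun t ht => ?_) fun σ hσ => ?_
    · have hB : B (γ t) ≤ K + 2 := by
        refine le_of_mul_le_mul_left ?_ hlt
        linarith [hγ_mu t]
      refine hR _ hB ?_
      have h₁ := mul_le_mul_of_nonneg_left hB (hJpos hlam).le
      have h₂ := mul_le_mul_of_nonneg_left hmu_one.le (by positivity : 0 ≤ K + 1)
      linarith [hγ_lam t]
    · have hγ' := Γ_mono mu lam hmu_mem.2.le hγ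
      rw [hΓ] at hγ'
      have hσΓ : σ ∈ Γ lam := by
        rw [hΓ]
        have h₀ := hσ ⟨0, by norm_num⟩ (by rw [hγ'.1, hzero lam hlam]; linarith)
        have h₁ := hσ ⟨1, by norm_num⟩ (by linarith [hγ'.2])
        exact ⟨h₀.trans hγ'.1, h₁ ▸ hγ'.2⟩
      obtain ⟨t, ht⟩ := exists_eq_iSup_comp (hcont lam hlam) σ
      exact ⟨t, ht ▸ c_le lam hlam σ hσΓ⟩
  choose v hv_norm hv_ge hv_le hv_deriv using
    fun n : ℕ => almost_critical (1 / ((n : ℝ) + 1)) Nat.one_div_pos_of_nat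
  have hlim : Tendsto (fun n : ℕ => 1 / ((n : ℝ) + 1)) atTop (𝓝 0) :=
    tendsto_one_div_add_atTop_nhds_zero_nat
  refine ⟨v, ⟨R + 1, fun n => (hv_norm n).trans ?_⟩, ?_, ?_⟩
  · have : 1 / ((n : ℝ) + 1) ≤ 1 := by
      rw [div_le_one (by positivity)]
      linarith [n.cast_nonneg (α := ℝ)]
    linarith
  · refine tendsto_of_tendsto_of_tendsto_of_le_of_le tendsto_const_nhds ?_ hv_ge hv_le
    simpa using (hlim.pow 2).const_add (c lam)
  · exact squeeze_zero (fun n => norm_nonneg _) hv_deriv (by simpa using hlim.const_mul 2)
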